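/- For every bounded open subset Ω of ℝ² whose boundary has finite length (rectifiable), 4π·area(Ω) ≤ perimeter(Ω)², i.e., the Polsby-Popper score PP(Ω) = 4π·area(Ω)/perimeter(Ω)² satisfies 0 ≤ PP(Ω) ≤ 1. -/

import Mathlib

open MeasureTheory Real
open Set Filter Topology

theorem strictMono_add_sin_mul_cos : StrictMono fun t : ℝ => t + sin t * cos t := by
  intro a b hab
  have h1 : sin a * cos a - sin b * cos b = -(sin (b - a) * cos (a + b)) := by
    rw [sin_sub, cos_add]
    linear_combination (-sin a * cos a) * (sin_sq_add_cos_sq b) + sin b * cos b * sin_sq_add_cos_sq a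
  have h2 : sin (b - a) * cos (a + b) ≥ -|sin (b - a)| := by
    have := neg_abs_le (sin (b - a) * cos (a + b))
    rw [abs_mul] at this
    nlinarith [abs_cos_le_one (a + b), abs_nonneg (sin (b - a))]
  have h3 : |sin (b - a)| < b - a := by
    have := abs_sin_lt_abs (x := b - a) (by linarith)
    rwa [abs_of_pos (by linarith : 0 < b - a)] at this
  show a + sin a * cos a < b + sin b * cos b
  linarith

/-- The normalized area of the part of the unit disc to the left of the abscissa `S` has an
inverse; here `C` is the half-height of the disc at that abscissa. -/
theorem exists_disc_abscissa : ∃ S C : ℝ → ℝ, Continuous S ∧ Continuous C ∧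
    ∀ v ∈ Ioo (-(π / 2)) (π / 2), S v ^ 2 + C v ^ 2 = 1 ∧ 0 < C v ∧
      HasDerivAt S (1 / (2 * C v)) v := by
  set G : ℝ → ℝ := fun t => t + sin t * cos t with hG
  have hGc : Continuous G := by fun_prop
  have hm : StrictMono G := strictMono_add_sin_mul_cos
  have hb : ∀ t, |sin t * cos t| ≤ 1 := fun t => by
    rw [abs_mul]
    exact mul_le_one₀ (abs_sin_le_one t) (abs_nonneg _) (abs_cos_le_one t)
  have hs : Function.Surjective G := by
    refine hGc.surjective ?_ ?_
    · exact tendsto_atTop_mono (fun t => by have := abs_le.1 (hb t); simp only [hG, id]; linarith)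
        (tendsto_atTop_add_const_right _ (-1) tendsto_id)
    · exact tendsto_atBot_mono (fun t => by have := abs_le.1 (hb t); simp only [hG, id]; linarith)
        (tendsto_atBot_add_const_right _ 1 tendsto_id)
  set e := hm.orderIsoOfSurjective G hs
  have heG : ∀ v, G (e.symm v) = v := fun v => hm.orderIsoOfSurjective_self_symm_apply G hs v
  have hθ : Continuous e.symm := e.symm.continuous
  refine ⟨fun v => sin (e.symm v), fun v => cos (e.symm v), by fun_prop, by fun_prop, ?_⟩
  rintro v ⟨hv1, hv2⟩
  have hlo : -(π / 2) < e.symm v := by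
    rw [← hm.lt_iff_lt, heG]; simpa [hG] using hv1
  have hhi : e.symm v < π / 2 := by
    rw [← hm.lt_iff_lt, heG]; simpa [hG] using hv2
  have hC : 0 < cos (e.symm v) := cos_pos_of_mem_Ioo ⟨hlo, hhi⟩
  refine ⟨sin_sq_add_cos_sq _, hC, ?_⟩
  have hGd : HasDerivAt G (2 * cos (e.symm v) ^ 2) (e.symm v) := by
    have := (hasDerivAt_id (e.symm v)).add
      ((hasDerivAt_sin (e.symm v)).mul (hasDerivAt_cos (e.symm v)))
    refine this.congr_deriv ?_
    linear_combination (sin_sq_add_cos_sq (e.symm v)) * (-1 : ℝ)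
  have hd := HasDerivAt.of_local_left_inverse hθ.continuousAt hGd (by positivity)
    (Eventually.of_forall heG)
  refine hd.sin.congr_deriv ?_
  field_simp

theorem integrable_deriv_of_nonneg_of_bounded {φ φ' : ℝ → ℝ} (hφ : ∀ x, HasDerivAt φ (φ' x) x)
    (h0 : ∀ x, 0 ≤ φ' x) (hb : ∀ x, |φ x| ≤ 1) : Integrable φ' := by
  have hmono : Monotone φ := monotone_of_deriv_nonneg (fun x => (hφ x).differentiableAt)
    (fun x => by rw [(hφ x).deriv]; exact h0 x)
  have hT := tendsto_atTop_ciSup hmono ⟨1, by rintro _ ⟨x, rfl⟩; exact (abs_le.1 (hb x)).2⟩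
  have hB := tendsto_atBot_ciInf hmono ⟨-1, by rintro _ ⟨x, rfl⟩; exact (abs_le.1 (hb x)).1⟩
  have h1 : IntegrableOn φ' (Ioi 0) :=
    integrableOn_Ioi_deriv_of_nonneg' (fun x _ => hφ x) (fun x _ => h0 x) hT
  have h2 : IntegrableOn φ' (Iic 0) := by
    have hd : ∀ x, HasDerivAt (fun x => -φ (-x)) (φ' (-x)) x := fun x =>
      ((hφ (-x)).comp x (hasDerivAt_neg x)).neg.congr_deriv (by ring)
    have h3 : IntegrableOn (fun x => φ' (-x)) (Ioi (-0)) :=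
      integrableOn_Ioi_deriv_of_nonneg' (fun x _ => hd x)
        (fun x _ => h0 _) (hB.comp tendsto_neg_atTop_atBot).neg
    have h4 : IntegrableOn (fun x => φ' (- -x)) (Iio 0) := h3.comp_neg_Iio
    simp only [neg_neg] at h4
    rwa [integrableOn_Iic_iff_integrableOn_Iio]
  rw [← integrableOn_univ, ← Iic_union_Ioi (a := (0 : ℝ))]
  exact h2.union h1

theorem integrable_mul_deriv_and_integral_eq {u u' φ φ' : ℝ → ℝ} {K : ℝ}
    (hu : ∀ x, HasDerivAt u (u' x) x) (hK : ∀ x, |u x| ≤ K) (hui : Integrable u)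
    (hui' : Integrable u') (hφ : ∀ x, HasDerivAt φ (φ' x) x)
    (h0 : ∀ x, 0 ≤ φ' x) (hb : ∀ x, |φ x| ≤ 1) :
    Integrable (fun x => u x * φ' x) ∧ ∫ x, u x * φ' x = -∫ x, u' x * φ x := by
  have huc : Continuous u := continuous_iff_continuousAt.2 fun x => (hu x).continuousAt
  have hφc : Continuous φ := continuous_iff_continuousAt.2 fun x => (hφ x).continuousAt
  have h1 : Integrable (fun x => u x * φ' x) :=
    (integrable_deriv_of_nonneg_of_bounded hφ h0 hb).bdd_mul huc.aestronglyMeasurable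
      (Eventually.of_forall hK)
  refine ⟨h1, integral_mul_deriv_eq_deriv_mul_of_integrable (fun x _ => hu x) (fun x _ => hφ x) h1
    ?_ ?_⟩
  · exact hui'.mul_bdd hφc.aestronglyMeasurable (Eventually.of_forall hb)
  · exact hui.mul_bdd hφc.aestronglyMeasurable (Eventually.of_forall hb)

theorem distribution_of_pos_continuous {f : ℝ → ℝ} (hc : Continuous f) (hpos : ∀ x, 0 < f x)
    (hi : Integrable f) : 0 < ∫ x, f x ∧
    ∀ x, 0 < (∫ t in Iic x, f t) / (∫ t, f t) ∧ (∫ t in Iic x, f t) / (∫ t, f t) < 1 ∧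
      HasDerivAt (fun x => (∫ t in Iic x, f t) / (∫ t, f t)) (f x / ∫ t, f t) x := by
  have hsupp : Function.support f = univ := by ext x; simp [(hpos x).ne']
  have hset : ∀ s : Set ℝ, volume s ≠ 0 → 0 < ∫ t in s, f t := fun s hs => by
    rw [setIntegral_pos_iff_support_of_nonneg_ae (Eventually.of_forall fun x => (hpos x).le)
      hi.integrableOn, hsupp, univ_inter]
    exact pos_iff_ne_zero.2 hs
  have hM : 0 < ∫ x, f x := by simpa using hset univ (by simp)
  refine ⟨hM, fun x => ⟨div_pos (hset _ (by simp)) hM, ?_, ?_⟩⟩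
  · rw [div_lt_one hM, ← intervalIntegral.integral_Iic_add_Ioi (b := x) hi.integrableOn hi.integrableOn]
    linarith [hset (Ioi x) (by simp)]
  · have h1 : (fun x => ∫ t in Iic x, f t) = fun x => (∫ t in Iic 0, f t) + ∫ t in (0 : ℝ)..x, f t := by
      ext x
      rw [← intervalIntegral.integral_Iic_sub_Iic hi.integrableOn hi.integrableOn]; ring
    refine HasDerivAt.div_const ?_ _
    rw [h1]
    exact (intervalIntegral.integral_hasDerivAt_right hi.intervalIntegrable
      hc.stronglyMeasurable.stronglyMeasurableAtFilter hc.continuousAt).const_add _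

theorem integral_mul_deriv_snd {U V T T' : ℝ × ℝ → ℝ} {K : ℝ}
    (hU : ∀ x y, HasDerivAt (fun s => U (x, s)) (V (x, y)) y) (hK : ∀ p, |U p| ≤ K)
    (hUi : Integrable U) (hVi : Integrable V)
    (hT : ∀ x y, HasDerivAt (fun s => T (x, s)) (T' (x, y)) y)
    (hTm : Measurable T) (hTm' : Measurable T') (h0 : ∀ p, 0 ≤ T' p) (hb : ∀ p, |T p| ≤ 1)
    (hU0 : ∀ p, 0 ≤ U p) :
    Integrable (fun p => V p * T p) ∧ Integrable (fun p => U p * T' p) ∧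
      ∫ p, U p * T' p = -∫ p, V p * T p := by
  have hVT : Integrable (fun p => V p * T p) :=
    hVi.mul_bdd hTm.aestronglyMeasurable (Eventually.of_forall hb)
  have key : ∀ᵐ x : ℝ, Integrable (fun y => U (x, y) * T' (x, y)) ∧
      ∫ y, U (x, y) * T' (x, y) = -∫ y, V (x, y) * T (x, y) := by
    filter_upwards [hUi.prod_right_ae, hVi.prod_right_ae] with x h1 h2
    exact integrable_mul_deriv_and_integral_eq (hU x) (fun y => hK _) h1 h2 (hT x)
      (fun y => h0 _) (fun y => hb _)
  have hint : Integrable (fun p => U p * T' p) := by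
    rw [Measure.volume_eq_prod] at hVT hUi ⊢
    refine (integrable_prod_iff (f := fun p => U p * T' p)
      (hUi.aestronglyMeasurable.mul hTm'.aestronglyMeasurable)).2
      ⟨key.mono fun x hx => hx.1, hVT.integral_prod_left.neg.congr ?_⟩
    filter_upwards [key] with x hx
    simp only [norm_mul, norm_of_nonneg (hU0 _), norm_of_nonneg (h0 _), Pi.neg_apply, hx.2]
  refine ⟨hVT, hint, ?_⟩
  rw [Measure.volume_eq_prod] at hVT hint ⊢
  rw [integral_prod _ hint, integral_prod _ hVT, ← integral_neg]
  exact integral_congr_ae (key.mono fun x hx => hx.2)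

theorem integral_mul_deriv_fst {U V T T' : ℝ × ℝ → ℝ} {K : ℝ}
    (hU : ∀ x y, HasDerivAt (fun s => U (s, y)) (V (x, y)) x) (hK : ∀ p, |U p| ≤ K)
    (hUi : Integrable U) (hVi : Integrable V)
    (hT : ∀ x y, HasDerivAt (fun s => T (s, y)) (T' (x, y)) x)
    (hTm : Measurable T) (hTm' : Measurable T') (h0 : ∀ p, 0 ≤ T' p) (hb : ∀ p, |T p| ≤ 1)
    (hU0 : ∀ p, 0 ≤ U p) :
    Integrable (fun p => V p * T p) ∧ Integrable (fun p => U p * T' p) ∧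
      ∫ p, U p * T' p = -∫ p, V p * T p := by
  obtain ⟨h1, h2, h3⟩ := integral_mul_deriv_snd (U := U ∘ Prod.swap) (V := V ∘ Prod.swap)
    (T := T ∘ Prod.swap) (T' := T' ∘ Prod.swap) (fun x y => hU y x) (fun p => hK _) hUi.swap hVi.swap
    (fun x y => hT y x) (hTm.comp measurable_swap) (hTm'.comp measurable_swap) (fun p => h0 _)
    (fun p => hb _) (fun p => hU0 _)
  refine ⟨h1.swap, h2.swap, ?_⟩
  have e1 := integral_prod_swap (μ := (volume : Measure ℝ)) (ν := (volume : Measure ℝ))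
    (fun p => U p * T' p)
  have e2 := integral_prod_swap (μ := (volume : Measure ℝ)) (ν := (volume : Measure ℝ))
    (fun p => V p * T p)
  rw [Measure.volume_eq_prod] at h3 ⊢
  rw [← e1, ← e2]
  exact h3

/-- The sharp Sobolev inequality in the plane, proved with the Knothe map that transports the
density `U ^ 2` to the uniform density on the unit disc. -/
theorem four_pi_mul_integral_sq_le {U Ux Uy g : ℝ × ℝ → ℝ} {K : ℝ} {h : ℝ → ℝ}
    (hUc : Continuous U) (hpos : ∀ p, 0 < U p) (hK : ∀ p, U p ≤ K) (hUi : Integrable U)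
    (hh : Integrable h) (hdom : ∀ x y, U (x, y) ^ 2 ≤ h y)
    (hUx : ∀ x y, HasDerivAt (fun s => U (s, y)) (Ux (x, y)) x)
    (hUy : ∀ x y, HasDerivAt (fun s => U (x, s)) (Uy (x, y)) y)
    (hUxm : Measurable Ux) (hUym : Measurable Uy) (hg : Integrable g)
    (hgrad : ∀ p, √(Ux p ^ 2 + Uy p ^ 2) ≤ g p) :
    4 * π * ∫ p, U p ^ 2 ≤ (∫ p, g p) ^ 2 := by
  obtain ⟨S, C, hS, hC, hSC⟩ := exists_disc_abscissa
  have habs : ∀ p, |U p| ≤ K := fun p => by rw [abs_of_pos (hpos p)]; exact hK p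
  have hUxi : Integrable Ux := hg.mono' hUxm.aestronglyMeasurable
    (Eventually.of_forall fun p => (abs_le_sqrt (by nlinarith [sq_nonneg (Uy p)])).trans (hgrad p))
  have hUyi : Integrable Uy := hg.mono' hUym.aestronglyMeasurable
    (Eventually.of_forall fun p => (abs_le_sqrt (by nlinarith [sq_nonneg (Ux p)])).trans (hgrad p))
  have hU2i : Integrable (fun p => U p ^ 2) := by
    simp only [sq]
    exact hUi.mul_bdd hUc.aestronglyMeasurable (Eventually.of_forall habs)
  have hnorm : ∀ x y, ‖U (x, y) ^ 2‖ ≤ h y := fun x y => by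
    rw [norm_of_nonneg (by positivity)]; exact hdom x y
  have hsl : ∀ x, Integrable (fun y => U (x, y) ^ 2) := fun x =>
    hh.mono' (Continuous.aestronglyMeasurable (by fun_prop)) (Eventually.of_forall (hnorm x))
  have hdist := fun x => distribution_of_pos_continuous (f := fun y => U (x, y) ^ 2) (by fun_prop)
    (fun y => by have := hpos (x, y); positivity) (hsl x)
  set m : ℝ → ℝ := fun x => ∫ y, U (x, y) ^ 2 with hm
  have hmpos : ∀ x, 0 < m x := fun x => (hdist x).1
  have hmc : Continuous m := continuous_of_dominated (bound := h)
    (fun x => (hsl x).aestronglyMeasurable) (fun x => Eventually.of_forall (hnorm x)) hh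
    (Eventually.of_forall fun y => by fun_prop)
  have hmi : Integrable m := by
    rw [Measure.volume_eq_prod] at hU2i
    exact hU2i.integral_prod_left
  set M : ℝ := ∫ p, U p ^ 2 with hM
  have hMm : ∫ x, m x = M := by
    rw [Measure.volume_eq_prod] at hU2i
    rw [hM, Measure.volume_eq_prod, integral_prod _ hU2i]
  obtain ⟨hMpos, hF⟩ := distribution_of_pos_continuous hmc hmpos hmi
  rw [hMm] at hMpos hF
  set F : ℝ → ℝ := fun x => (∫ t in Iic x, m t) / M with hFdef
  set v : ℝ → ℝ := fun x => π * F x - π / 2 with hv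
  have hvmem : ∀ x, v x ∈ Ioo (-(π / 2)) (π / 2) := fun x => by
    have h1 : 0 < F x := (hF x).1
    have h2 : F x < 1 := (hF x).2.1
    have := pi_pos
    constructor <;> simp only [hv] <;> nlinarith
  have hvd : ∀ x, HasDerivAt v (π * (m x / M)) x := fun x =>
    ((hF x).2.2.const_mul π).sub_const _
  have hvc : Continuous v := continuous_iff_continuousAt.2 fun x => (hvd x).continuousAt
  have hCp : ∀ x, 0 < C (v x) := fun x => (hSC _ (hvmem x)).2.1
  set Φ : ℝ × ℝ → ℝ := fun p => (∫ t in Iic p.2, U (p.1, t) ^ 2) / m p.1 with hΦ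
  have hΦ0 : ∀ p, 0 < Φ p := fun p => ((hdist p.1).2 p.2).1
  have hΦ1 : ∀ p, Φ p < 1 := fun p => ((hdist p.1).2 p.2).2.1
  have hΦd : ∀ x y, HasDerivAt (fun s => Φ (x, s)) (U (x, y) ^ 2 / m x) y :=
    fun x y => ((hdist x).2 y).2.2
  have hΦm : Measurable Φ := by
    have : Measurable (Function.uncurry fun y x => Φ (x, y)) := by
      refine measurable_uncurry_of_continuous_of_measurable
        (fun x => continuous_iff_continuousAt.2 fun y => (hΦd x y).continuousAt) fun y => ?_
      refine Measurable.div (Continuous.measurable ?_) hmc.measurable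
      change Continuous fun x => ∫ t in Iic y, U (x, t) ^ 2
      exact continuous_of_dominated (bound := h)
        (fun x => (hsl x).aestronglyMeasurable.restrict)
        (fun x => Eventually.of_forall (hnorm x)) hh.restrict
        (Eventually.of_forall fun y => by fun_prop)
    exact this.comp measurable_swap
  set T₁ : ℝ × ℝ → ℝ := fun p => S (v p.1) with hT₁
  set T₁' : ℝ × ℝ → ℝ := fun p => 1 / (2 * C (v p.1)) * (π * (m p.1 / M)) with hT₁'
  set T₂ : ℝ × ℝ → ℝ := fun p => C (v p.1) * (2 * Φ p - 1) with hT₂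
  set T₂' : ℝ × ℝ → ℝ := fun p => C (v p.1) * (2 * (U p ^ 2 / m p.1)) with hT₂'
  have hTle : ∀ p, T₁ p ^ 2 + T₂ p ^ 2 ≤ 1 := fun p => by
    have h1 := (hSC _ (hvmem p.1)).1
    have h2 : (2 * Φ p - 1) ^ 2 ≤ 1 := by nlinarith [hΦ0 p, hΦ1 p]
    simp only [hT₁, hT₂, mul_pow]
    nlinarith [sq_nonneg (C (v p.1))]
  have h1p : ∀ p, 0 < T₁' p := fun p => by
    have := hCp p.1
    have := hmpos p.1
    simp only [hT₁']
    positivity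
  have h2p : ∀ p, 0 < T₂' p := fun p => by
    have := hCp p.1
    have := hmpos p.1
    have := hpos p
    simp only [hT₂']
    positivity
  obtain ⟨a1, a2, a3⟩ := integral_mul_deriv_fst (T := T₁) (T' := T₁') hUx habs hUi hUxi
    (fun x y => (hSC _ (hvmem x)).2.2.comp x (hvd x)) (by fun_prop) (by fun_prop)
    (fun p => (h1p p).le)
    (fun p => (sq_le_one_iff_abs_le_one _).1 (by nlinarith [hTle p, sq_nonneg (T₂ p)]))
    (fun p => (hpos p).le)
  obtain ⟨b1, b2, b3⟩ := integral_mul_deriv_snd (T := T₂) (T' := T₂') hUy habs hUi hUyi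
    (fun x y => (((hΦd x y).const_mul 2).sub_const 1).const_mul (C (v x)))
    (by fun_prop) (by fun_prop)
    (fun p => (h2p p).le)
    (fun p => (sq_le_one_iff_abs_le_one _).1 (by nlinarith [hTle p, sq_nonneg (T₁ p)]))
    (fun p => (hpos p).le)
  have amgm : ∀ p, 2 * √(π / M) * U p ^ 2 ≤ U p * T₁' p + U p * T₂' p := fun p => by
    have hprod : T₁' p * T₂' p = (√(π / M) * U p) ^ 2 := by
      have := hCp p.1
      have := hmpos p.1
      rw [mul_pow, sq_sqrt (by positivity)]
      simp only [hT₁', hT₂']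
      field_simp
    have h1 : 2 * (√(π / M) * U p) ≤ T₁' p + T₂' p := by
      refine abs_le_of_sq_le_sq' ?_ (add_pos (h1p p) (h2p p)).le |>.2
      rw [mul_pow, ← hprod]
      nlinarith [sq_nonneg (T₁' p - T₂' p)]
    nlinarith [hpos p]
  have cs : ∀ p, -(Ux p * T₁ p + Uy p * T₂ p) ≤ g p := fun p => by
    refine le_trans ?_ (hgrad p)
    refine le_sqrt_of_sq_le ?_
    nlinarith [sq_nonneg (Ux p * T₂ p - Uy p * T₁ p), hTle p, sq_nonneg (Ux p), sq_nonneg (Uy p),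
      mul_nonneg (add_nonneg (sq_nonneg (Ux p)) (sq_nonneg (Uy p))) (sub_nonneg.2 (hTle p))]
  have main : 2 * √(π / M) * M ≤ ∫ p, g p := calc
    2 * √(π / M) * M = ∫ p, 2 * √(π / M) * U p ^ 2 := by rw [integral_const_mul]
    _ ≤ ∫ p, (U p * T₁' p + U p * T₂' p) := integral_mono (hU2i.const_mul _) (a2.add b2) amgm
    _ = ∫ p, -(Ux p * T₁ p + Uy p * T₂ p) := by
      rw [integral_add a2 b2, a3, b3, integral_neg, integral_add a1 b1]; ring
    _ ≤ ∫ p, g p := integral_mono (a1.add b1).neg hg cs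
  calc 4 * π * M = (2 * √(π / M) * M) ^ 2 := by
        rw [mul_pow, mul_pow, sq_sqrt (by positivity)]; field_simp; norm_num
    _ ≤ _ := pow_le_pow_left₀ (by positivity) main 2

/-- The region swept out when a set is translated backwards in direction `e` up to time `h`. -/
def sweep (e : EuclideanSpace ℝ (Fin 2)) (h : ℝ) (A : Set (EuclideanSpace ℝ (Fin 2))) :
    Set (EuclideanSpace ℝ (Fin 2)) :=
  (fun q : EuclideanSpace ℝ (Fin 2) × ℝ => q.1 - q.2 • e) '' (A ×ˢ Icc 0 h)

theorem mem_sweep {e z : EuclideanSpace ℝ (Fin 2)} {h : ℝ} {A : Set (EuclideanSpace ℝ (Fin 2))} :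
    z ∈ sweep e h A ↔ ∃ p ∈ A, ∃ t ∈ Icc 0 h, p - t • e = z := by
  simp only [sweep, mem_image, mem_prod, Prod.exists]
  exact ⟨fun ⟨p, t, ⟨hp, ht⟩, h⟩ => ⟨p, hp, t, ht, h⟩, fun ⟨p, hp, t, ht, h⟩ => ⟨p, t, ⟨hp, ht⟩, h⟩⟩

theorem volume_sweep_le_ediam (e : EuclideanSpace ℝ (Fin 2)) (he : ‖e‖ = 1) (h : ℝ)
    (A : Set (EuclideanSpace ℝ (Fin 2))) :
    volume (sweep e h A) ≤ (ENNReal.ofReal h + Metric.ediam A) * Metric.ediam A := by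
  obtain ⟨b, hb⟩ := Orthonormal.exists_orthonormalBasis_extension_of_card_eq (𝕜 := ℝ)
    (E := EuclideanSpace ℝ (Fin 2)) (ι := Fin 2) (by simp) (v := fun _ => e) (s := {0})
    ⟨fun i => he, fun i j hij => (hij (Subsingleton.elim i j)).elim⟩
  have hb0 : b 0 = e := hb 0 rfl
  have h0 : inner ℝ (b 0) e = 1 := by rw [hb0, real_inner_self_eq_norm_sq, he]; norm_num
  have h1 : inner ℝ (b 1) e = 0 := by rw [← hb0]; exact b.orthonormal.2 (by decide)
  have hlip : ∀ (i : Fin 2) (p q), edist (inner ℝ (b i) p : ℝ) (inner ℝ (b i) q) ≤ edist p q := by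
    intro i p q
    rw [edist_dist, edist_dist]
    refine ENNReal.ofReal_le_ofReal ?_
    rw [Real.dist_eq, ← inner_sub_right, dist_eq_norm]
    refine (abs_real_inner_le_norm _ _).trans ?_
    rw [b.orthonormal.1 i, one_mul]
  set f : EuclideanSpace ℝ (Fin 2) ≃ᵐ (Fin 2 → ℝ) :=
    b.measurableEquiv.trans (MeasurableEquiv.toLp 2 (Fin 2 → ℝ)).symm
  have hf : MeasurePreserving f :=
    (EuclideanSpace.volume_preserving_symm_measurableEquiv_toLp (Fin 2)).comp
      b.measurePreserving_measurableEquiv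
  have hfi : ∀ z i, f z i = inner ℝ (b i) z := fun z i => b.repr_apply_apply z i
  calc volume (sweep e h A) = volume (f '' sweep e h A) := by
        rw [← hf.measure_preimage_equiv, f.injective.preimage_image]
    _ ≤ ∏ i, Metric.ediam (Function.eval i '' (f '' sweep e h A)) :=
        Real.volume_pi_le_prod_diam _
    _ ≤ _ := by
      rw [Fin.prod_univ_two]
      refine mul_le_mul' (Metric.ediam_le ?_) (Metric.ediam_le ?_)
      · rintro _ ⟨_, ⟨z, hz, rfl⟩, rfl⟩ _ ⟨_, ⟨z', hz', rfl⟩, rfl⟩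
        obtain ⟨p, hp, t, ht, rfl⟩ := mem_sweep.1 hz
        obtain ⟨p', hp', t', ht', rfl⟩ := mem_sweep.1 hz'
        simp only [Function.eval, hfi, inner_sub_right, inner_smul_right, h0, mul_one]
        rw [sub_eq_add_neg, sub_eq_add_neg, add_comm (ENNReal.ofReal h)]
        refine (edist_add_add_le _ _ _ _).trans (add_le_add ?_ ?_)
        · exact (hlip 0 p p').trans (Metric.edist_le_ediam_of_mem hp hp')
        · rw [edist_neg_neg, edist_dist, Real.dist_eq]
          refine ENNReal.ofReal_le_ofReal (abs_le.2 ⟨?_, ?_⟩) <;> linarith [ht.1, ht.2, ht'.1, ht'.2]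
      · rintro _ ⟨_, ⟨z, hz, rfl⟩, rfl⟩ _ ⟨_, ⟨z', hz', rfl⟩, rfl⟩
        obtain ⟨p, hp, t, ht, rfl⟩ := mem_sweep.1 hz
        obtain ⟨p', hp', t', ht', rfl⟩ := mem_sweep.1 hz'
        simp only [Function.eval, hfi, inner_sub_right, inner_smul_right, h1, mul_zero, sub_zero]
        exact (hlip 1 p p').trans (Metric.edist_le_ediam_of_mem hp hp')

theorem volume_sweep_le (e : EuclideanSpace ℝ (Fin 2)) (he : ‖e‖ = 1) {h : ℝ} (hh : 0 < h)
    (A : Set (EuclideanSpace ℝ (Fin 2))) :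
    volume (sweep e h A) ≤ ENNReal.ofReal h * μH[1] A := by
  rcases eq_or_ne (μH[1] A) ⊤ with htop | htop
  · rw [htop, ENNReal.mul_top (by simpa using hh)]; exact le_top
  have hr : ∀ r : ℝ, 0 < r →
      volume (sweep e h A) ≤ (ENNReal.ofReal h + ENNReal.ofReal r) * μH[1] A := by
    intro r hr
    rw [← ENNReal.div_le_iff' (by simp [hh]) (by finiteness), Measure.hausdorffMeasure_apply]
    refine le_trans ?_ (le_iSup₂ (ENNReal.ofReal r) (by simpa using hr))
    refine le_iInf fun t => le_iInf fun hA => le_iInf fun ht => ?_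
    refine ENNReal.div_le_of_le_mul' ?_
    rw [← ENNReal.tsum_mul_left]
    have hsub : sweep e h A ⊆ ⋃ n, sweep e h (t n) := by
      intro z hz
      obtain ⟨p, hp, s, hs, rfl⟩ := mem_sweep.1 hz
      obtain ⟨n, hn⟩ := mem_iUnion.1 (hA hp)
      exact mem_iUnion.2 ⟨n, mem_sweep.2 ⟨p, hn, s, hs, rfl⟩⟩
    refine (measure_mono hsub).trans ((measure_iUnion_le _).trans (ENNReal.tsum_le_tsum fun n => ?_))
    rcases (t n).eq_empty_or_nonempty with hn | hn
    · simp [hn, sweep]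
    · refine (volume_sweep_le_ediam e he h _).trans ?_
      simp only [hn, iSup_pos, ENNReal.rpow_one]
      gcongr
      exact ht n
  have hlim : Tendsto (fun r : ℝ => (ENNReal.ofReal h + ENNReal.ofReal r) * μH[1] A) (𝓝[>] 0)
      (𝓝 ((ENNReal.ofReal h + ENNReal.ofReal 0) * μH[1] A)) := by
    refine ENNReal.Tendsto.mul_const ?_ (Or.inr htop)
    exact ((ENNReal.continuous_ofReal.tendsto 0).const_add _).mono_left nhdsWithin_le_nhds
  rw [ENNReal.ofReal_zero, add_zero] at hlim
  exact ge_of_tendsto hlim (eventually_nhdsWithin_of_forall hr)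

theorem lintegral_sweep_le (e : EuclideanSpace ℝ (Fin 2)) (he : ‖e‖ = 1) {h η : ℝ} (hh : 0 < h)
    (hη : 0 ≤ η) {A : Set (EuclideanSpace ℝ (Fin 2))} {w : EuclideanSpace ℝ (Fin 2) → ℝ}
    (hw : Continuous w) (hw0 : ∀ z, 0 ≤ w z)
    (hwη : ∀ z, ∀ t ∈ Icc 0 h, w (z - t • e) ≤ w z + η) :
    ∫⁻ z in sweep e h A, ENNReal.ofReal (w z) ≤
      ENNReal.ofReal h * ∫⁻ z in A, ENNReal.ofReal (w z + η) ∂μH[1] := by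
  rw [lintegral_eq_lintegral_meas_lt _ (Eventually.of_forall hw0) hw.aemeasurable,
    lintegral_eq_lintegral_meas_lt _ (Eventually.of_forall fun z => add_nonneg (hw0 z) hη)
      (by fun_prop), ← lintegral_const_mul' _ _ ENNReal.ofReal_ne_top]
  refine lintegral_mono fun t => ?_
  rw [Measure.restrict_apply (measurableSet_lt measurable_const hw.measurable),
    Measure.restrict_apply (measurableSet_lt measurable_const (by fun_prop))]
  refine le_trans (measure_mono ?_) (volume_sweep_le e he hh _)
  rintro z ⟨hz, hzA⟩
  obtain ⟨p, hp, s, hs, rfl⟩ := mem_sweep.1 hzA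
  exact mem_sweep.2 ⟨p, ⟨lt_of_lt_of_le hz (hwη p s hs), hp⟩, s, hs, rfl⟩

theorem preimage_add_smul_subset {Ω : Set (EuclideanSpace ℝ (Fin 2))} (hΩ : IsOpen Ω)
    (e : EuclideanSpace ℝ (Fin 2)) {h : ℝ} (hh : 0 < h) :
    (fun z => z + h • e) ⁻¹' Ω ⊆ Ω ∪ sweep e h (frontier Ω) := by
  intro z hz
  by_contra hcon
  simp only [mem_union, not_or] at hcon
  obtain ⟨hz1, hz2⟩ := hcon
  have hno : ∀ t ∈ Icc 0 h, z + t • e ∉ frontier Ω := fun t ht hf =>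
    hz2 (mem_sweep.2 ⟨_, hf, t, ht, by simp⟩)
  have hcont : Continuous fun t : ℝ => z + t • e := by fun_prop
  obtain ⟨t, -, ht1, ht2⟩ := isPreconnected_Icc (a := (0 : ℝ)) (b := h)
    ((fun t : ℝ => z + t • e) ⁻¹' Ω) ((fun t : ℝ => z + t • e) ⁻¹' (closure Ω)ᶜ)
    (hΩ.preimage hcont) (isClosed_closure.isOpen_compl.preimage hcont)
    (fun t ht => by
      by_cases hc : z + t • e ∈ Ω
      · exact Or.inl hc
      · exact Or.inr fun hcl => hno t ht (by rw [hΩ.frontier_eq]; exact ⟨hcl, hc⟩))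
    ⟨h, ⟨hh.le, le_rfl⟩, hz⟩
    ⟨0, ⟨le_rfl, hh.le⟩, fun hcl => hno 0 ⟨le_rfl, hh.le⟩ (by
      rw [hΩ.frontier_eq]; exact ⟨hcl, by simpa using hz1⟩)⟩
  exact ht2 (subset_closure ht1)

theorem hasFDerivAt_setIntegral_comp_sub {k : EuclideanSpace ℝ (Fin 2) → ℝ}
    {k' : EuclideanSpace ℝ (Fin 2) → EuclideanSpace ℝ (Fin 2) →L[ℝ] ℝ} {B : ℝ}
    (hk' : ∀ z, HasFDerivAt k (k' z) z) (hk'c : Continuous k') (hB : ∀ z, ‖k' z‖ ≤ B)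
    (hki : Integrable k) {Ω : Set (EuclideanSpace ℝ (Fin 2))} (hΩ : volume Ω ≠ ⊤)
    (z : EuclideanSpace ℝ (Fin 2)) :
    HasFDerivAt (fun z => ∫ w in Ω, k (z - w)) (∫ w in Ω, k' (z - w)) z := by
  have hkc : Continuous k := continuous_iff_continuousAt.2 fun z => (hk' z).continuousAt
  have hfin : IsFiniteMeasure (volume.restrict Ω) := ⟨by simpa using hΩ.lt_top⟩
  refine hasFDerivAt_integral_of_dominated_of_fderiv_le (bound := fun _ => B)
    (F := fun z w => k (z - w)) (F' := fun z w => k' (z - w)) univ_mem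
    (Eventually.of_forall fun x => Continuous.aestronglyMeasurable (by fun_prop))
    (hki.comp_sub_left z).integrableOn (Continuous.aestronglyMeasurable (by fun_prop))
    (Eventually.of_forall fun w x _ => hB _) (integrable_const _)
    (Eventually.of_forall fun w x _ => ?_)
  exact (hk' (x - w)).comp x ((hasFDerivAt_id x).sub_const w)

theorem fderiv_apply_le_toReal_lintegral_frontier {k : EuclideanSpace ℝ (Fin 2) → ℝ} {B K : ℝ}
    (hkc : Continuous k) (hk0 : ∀ z, 0 ≤ k z) (hkK : ∀ z, k z ≤ K) (hki : Integrable k)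
    (hB0 : 0 ≤ B) (hB : ∀ z z', k z' ≤ k z + B * ‖z' - z‖)
    {Ω : Set (EuclideanSpace ℝ (Fin 2))} (hΩ : IsOpen Ω)
    (hrect : μH[1] (frontier Ω) < ⊤) {z e : EuclideanSpace ℝ (Fin 2)} (he : ‖e‖ = 1)
    {L : EuclideanSpace ℝ (Fin 2) →L[ℝ] ℝ}
    (hL : HasFDerivAt (fun z => ∫ w in Ω, k (z - w)) L z) :
    L e ≤ (∫⁻ w in frontier Ω, ENNReal.ofReal (k (z - w)) ∂μH[1]).toReal := by
  set u : EuclideanSpace ℝ (Fin 2) → ℝ := fun z => ∫ w in Ω, k (z - w) with hu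
  set G := ∫⁻ w in frontier Ω, ENNReal.ofReal (k (z - w)) ∂μH[1] with hG
  have hGtop : G ≠ ⊤ := by
    refine ne_top_of_le_ne_top ?_ (lintegral_mono fun w => ENNReal.ofReal_le_ofReal (hkK (z - w)))
    simp only [lintegral_const, Measure.restrict_apply_univ]
    finiteness
  have hu0 : ∀ z, 0 ≤ u z := fun z => integral_nonneg fun w => hk0 _
  have hul : ∀ z, ENNReal.ofReal (u z) = ∫⁻ w in Ω, ENNReal.ofReal (k (z - w)) := fun z =>
    ofReal_integral_eq_lintegral_ofReal (hki.comp_sub_left z).integrableOn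
      (Eventually.of_forall fun w => hk0 _)
  have hstep : ∀ h : ℝ, 0 < h →
      u (z + h • e) ≤ u z + h * (G.toReal + B * h * (μH[1] (frontier Ω)).toReal) := by
    intro h hh
    have e1 : ENNReal.ofReal (u (z + h • e)) ≤ ENNReal.ofReal (u z) + ENNReal.ofReal h *
        (G + ENNReal.ofReal (B * h) * μH[1] (frontier Ω)) := calc
      ENNReal.ofReal (u (z + h • e))
          = ∫⁻ w in (fun w => w + h • e) ⁻¹' Ω, ENNReal.ofReal (k (z - w)) := by
        rw [hul, ← (measurePreserving_add_right volume (h • e)).setLIntegral_comp_preimage_emb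
          (measurableEmbedding_addRight (h • e))]
        simp only [add_sub_add_right_eq_sub]
      _ ≤ ∫⁻ w in Ω ∪ sweep e h (frontier Ω), ENNReal.ofReal (k (z - w)) :=
        lintegral_mono_set (preimage_add_smul_subset hΩ e hh)
      _ ≤ ENNReal.ofReal (u z) + ∫⁻ w in sweep e h (frontier Ω), ENNReal.ofReal (k (z - w)) := by
        rw [hul]; exact lintegral_union_le _ _ _
      _ ≤ ENNReal.ofReal (u z) + ENNReal.ofReal h *
          ∫⁻ w in frontier Ω, ENNReal.ofReal (k (z - w) + B * h) ∂μH[1] := by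
        gcongr
        refine lintegral_sweep_le e he hh (by positivity) (by fun_prop) (fun w => hk0 _)
          fun w t ht => (hB (z - w) _).trans ?_
        rw [show z - (w - t • e) - (z - w) = t • e by abel, norm_smul, he, mul_one,
          norm_of_nonneg ht.1]
        gcongr
        exact ht.2
      _ = _ := by
        simp_rw [ENNReal.ofReal_add (hk0 _) (by positivity : 0 ≤ B * h)]
        rw [lintegral_add_right _ measurable_const, lintegral_const, Measure.restrict_apply_univ]
    have hG' : G = ENNReal.ofReal G.toReal := (ENNReal.ofReal_toReal hGtop).symm
    have hP' : μH[1] (frontier Ω) = ENNReal.ofReal (μH[1] (frontier Ω)).toReal :=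
      (ENNReal.ofReal_toReal hrect.ne).symm
    rw [hG', hP', ← ENNReal.ofReal_mul (by positivity), ← ENNReal.ofReal_add (by positivity)
      (by positivity), ← ENNReal.ofReal_mul hh.le, ← ENNReal.ofReal_add (hu0 z) (by positivity)]
      at e1
    exact (ENNReal.ofReal_le_ofReal_iff (add_nonneg (hu0 z) (by positivity))).1 e1
  have hd : HasDerivAt (fun t : ℝ => u (z + t • e)) (L e) 0 := by
    have h1 : HasDerivAt (fun t : ℝ => z + t • e) e 0 := by
      simpa using ((hasDerivAt_id (0 : ℝ)).smul_const e).const_add z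
    have h2 : HasFDerivAt u L (z + (0 : ℝ) • e) := by simpa using hL
    exact h2.comp_hasDerivAt 0 h1
  have hl1 := hd.tendsto_slope_zero_right
  have hl2 : Tendsto (fun h : ℝ => G.toReal + B * h * (μH[1] (frontier Ω)).toReal) (𝓝[>] 0)
      (𝓝 G.toReal) := by
    have : Continuous fun h : ℝ => G.toReal + B * h * (μH[1] (frontier Ω)).toReal := by fun_prop
    simpa using (this.tendsto 0).mono_left nhdsWithin_le_nhds
  refine le_of_tendsto_of_tendsto hl1 hl2 (eventually_nhdsWithin_of_forall fun h hh => ?_)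
  have hh' : 0 < h := hh
  have := hstep h hh'
  simp only [zero_add, zero_smul, add_zero, smul_eq_mul]
  rw [inv_mul_le_iff₀ hh']
  linarith

/-- The coordinate map from `ℝ × ℝ` to the Euclidean plane. -/
noncomputable def planeEquiv : ℝ × ℝ ≃ᵐ EuclideanSpace ℝ (Fin 2) :=
  MeasurableEquiv.finTwoArrow.symm.trans (MeasurableEquiv.toLp 2 (Fin 2 → ℝ))

theorem planeEquiv_apply (p : ℝ × ℝ) : planeEquiv p = !₂[p.1, p.2] := rfl

theorem measurePreserving_planeEquiv : MeasurePreserving planeEquiv :=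
  (PiLp.volume_preserving_toLp (Fin 2)).comp (volume_preserving_finTwoArrow ℝ).symm

theorem planeEquiv_eq_add_smul (x y : ℝ) : planeEquiv (x, y) =
    x • EuclideanSpace.single 0 1 + y • EuclideanSpace.single 1 1 := by
  ext i; fin_cases i <;> simp [planeEquiv_apply]

theorem four_pi_mul_integral_sq_mollified_le {k : EuclideanSpace ℝ (Fin 2) → ℝ} {B K : ℝ}
    {k' : EuclideanSpace ℝ (Fin 2) → EuclideanSpace ℝ (Fin 2) →L[ℝ] ℝ}
    (hk0 : ∀ z, 0 < k z) (hkK : ∀ z, k z ≤ K) (hki : Integrable k) (hk1 : ∫ z, k z = 1)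
    (hk' : ∀ z, HasFDerivAt k (k' z) z) (hk'c : Continuous k') (hB : ∀ z, ‖k' z‖ ≤ B)
    (hdom : ∀ R : ℝ, ∃ h : ℝ → ℝ, Integrable h ∧ ∀ z w : EuclideanSpace ℝ (Fin 2), ‖w‖ ≤ R →
      k (z - w) ≤ h (z 1))
    {Ω : Set (EuclideanSpace ℝ (Fin 2))} (hΩ : IsOpen Ω) (hne : Ω.Nonempty)
    (hb : Bornology.IsBounded Ω) (hrect : μH[1] (frontier Ω) < ⊤) :
    Continuous (fun z => ∫ w in Ω, k (z - w)) ∧ (∀ z, 0 ≤ ∫ w in Ω, k (z - w)) ∧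
      (∀ z, ∫ w in Ω, k (z - w) ≤ 1) ∧
      4 * π * ∫ z in Ω, (∫ w in Ω, k (z - w)) ^ 2 ≤ ((μH[1] (frontier Ω)).toReal) ^ 2 := by
  set u : EuclideanSpace ℝ (Fin 2) → ℝ := fun z => ∫ w in Ω, k (z - w) with hu
  have hvol : volume Ω < ⊤ := hb.measure_lt_top
  have hkc : Continuous k := continuous_iff_continuousAt.2 fun z => (hk' z).continuousAt
  have hud : ∀ z, HasFDerivAt u (∫ w in Ω, k' (z - w)) z :=
    hasFDerivAt_setIntegral_comp_sub hk' hk'c hB hki hvol.ne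
  have hudiff : Differentiable ℝ u := fun z => (hud z).differentiableAt
  have hB0 : 0 ≤ B := (norm_nonneg _).trans (hB 0)
  have hlip : ∀ z z', k z' ≤ k z + B * ‖z' - z‖ := fun z z' => by
    have := convex_univ.norm_image_sub_le_of_norm_hasFDerivWithin_le
      (fun x _ => (hk' x).hasFDerivWithinAt) (fun x _ => hB x) (mem_univ z) (mem_univ z')
    have := (abs_le.1 this).2
    linarith
  have hupos : ∀ z, 0 < u z := fun z => by
    rw [hu, setIntegral_pos_iff_support_of_nonneg_ae (Eventually.of_forall fun w => (hk0 _).le)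
      (hki.comp_sub_left z).integrableOn]
    have : Function.support (fun w => k (z - w)) = univ := by ext w; simp [(hk0 _).ne']
    rw [this, univ_inter]
    exact hΩ.measure_pos _ hne
  have hu1 : ∀ z, u z ≤ 1 := fun z => by
    refine (setIntegral_le_integral (hki.comp_sub_left z)
      (Eventually.of_forall fun w => (hk0 _).le)).trans ?_
    rw [integral_sub_left_eq_self (fun w => k w), hk1]
  have hlk : ∫⁻ z, ENNReal.ofReal (k z) = 1 := by
    rw [← ofReal_integral_eq_lintegral_ofReal hki (Eventually.of_forall fun w => (hk0 _).le), hk1,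
      ENNReal.ofReal_one]
  have hswap : ∀ (μ : Measure (EuclideanSpace ℝ (Fin 2))) [IsFiniteMeasure μ],
      ∫⁻ z, ∫⁻ w, ENNReal.ofReal (k (z - w)) ∂μ = μ univ := fun μ _ => by
    rw [lintegral_lintegral_swap (by fun_prop)]
    simp_rw [lintegral_sub_right_eq_self (fun z => ENNReal.ofReal (k z)), hlk]
    simp
  have hfin : IsFiniteMeasure (volume.restrict Ω) := ⟨by simpa using hvol⟩
  have hfin' : IsFiniteMeasure ((μH[1] : Measure (EuclideanSpace ℝ (Fin 2))).restrict
    (frontier Ω)) := ⟨by simpa using hrect⟩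
  have hui : Integrable u := by
    refine ⟨hudiff.continuous.aestronglyMeasurable, ?_⟩
    rw [hasFiniteIntegral_iff_ofReal (Eventually.of_forall fun z => (hupos z).le)]
    have : ∀ z, ENNReal.ofReal (u z) = ∫⁻ w in Ω, ENNReal.ofReal (k (z - w)) := fun z =>
      ofReal_integral_eq_lintegral_ofReal (hki.comp_sub_left z).integrableOn
        (Eventually.of_forall fun w => (hk0 _).le)
    simp_rw [this]
    rw [hswap]
    simpa using hvol
  set G : EuclideanSpace ℝ (Fin 2) → ENNReal := fun z =>
    ∫⁻ w in frontier Ω, ENNReal.ofReal (k (z - w)) ∂μH[1] with hG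
  have hGm : Measurable G := Measurable.lintegral_prod_right (by fun_prop)
  have hGint : ∫⁻ z, G z = μH[1] (frontier Ω) := by
    rw [hG, hswap]; simp
  have hGtop : ∀ᵐ z, G z < ⊤ := ae_lt_top hGm (by rw [hGint]; exact hrect.ne)
  have hg : Integrable (fun z => (G z).toReal) :=
    integrable_toReal_of_lintegral_ne_top hGm.aemeasurable (by rw [hGint]; exact hrect.ne)
  have hgint : ∫ z, (G z).toReal = (μH[1] (frontier Ω)).toReal := by
    rw [integral_toReal hGm.aemeasurable hGtop, hGint]
  obtain ⟨R, hR⟩ := hb.exists_norm_le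
  obtain ⟨h, hhi, hh⟩ := hdom R
  have hΨc : Continuous planeEquiv := by
    change Continuous fun p : ℝ × ℝ => planeEquiv (p.1, p.2)
    simp only [planeEquiv_eq_add_smul]
    fun_prop
  have hdir : ∀ e, Measurable fun p : ℝ × ℝ => fderiv ℝ u (planeEquiv p) e := fun e =>
    (measurable_fderiv_apply_const ℝ u e).comp planeEquiv.measurable
  have key := four_pi_mul_integral_sq_le (U := fun p => u (planeEquiv p))
    (Ux := fun p => fderiv ℝ u (planeEquiv p) (EuclideanSpace.single 0 1))
    (Uy := fun p => fderiv ℝ u (planeEquiv p) (EuclideanSpace.single 1 1))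
    (g := fun p => (G (planeEquiv p)).toReal) (h := fun y => h y * volume.real Ω) (K := 1)
    (hudiff.continuous.comp hΨc) (fun p => hupos _) (fun p => hu1 _)
    ((measurePreserving_planeEquiv.integrable_comp_emb planeEquiv.measurableEmbedding).2 hui)
    (hhi.mul_const _) ?_ ?_ ?_ (hdir _) (hdir _)
    ((measurePreserving_planeEquiv.integrable_comp_emb planeEquiv.measurableEmbedding).2 hg) ?_
  · rw [measurePreserving_planeEquiv.integral_comp' (fun z => u z ^ 2),
      measurePreserving_planeEquiv.integral_comp' (fun z => (G z).toReal), hgint] at key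
    refine ⟨hudiff.continuous, fun z => (hupos z).le, hu1, le_trans ?_ key⟩
    have hu2 : Integrable (fun z => u z ^ 2) := by
      simp only [sq]
      exact hui.mul_bdd (c := 1) hudiff.continuous.aestronglyMeasurable
        (Eventually.of_forall fun z => by rw [norm_of_nonneg (hupos z).le]; exact hu1 z)
    exact mul_le_mul_of_nonneg_left
      (setIntegral_le_integral hu2 (Eventually.of_forall fun z => sq_nonneg _)) (by positivity)
  · intro x y
    have h1 : u (planeEquiv (x, y)) ≤ h y * volume.real Ω := by
      have h2 : ∀ w ∈ Ω, k (planeEquiv (x, y) - w) ≤ h y := fun w hw => by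
        simpa [planeEquiv_apply] using hh (planeEquiv (x, y)) w (hR w hw)
      refine (setIntegral_mono_on (hki.comp_sub_left (planeEquiv (x, y))).integrableOn
        (integrable_const _) hΩ.measurableSet h2).trans ?_
      simp [mul_comm]
    nlinarith [hu1 (planeEquiv (x, y)), hupos (planeEquiv (x, y))]
  · intro x y
    have h1 : HasDerivAt (fun s => planeEquiv (s, y)) (EuclideanSpace.single 0 1) x := by
      simp only [planeEquiv_eq_add_smul]
      simpa using ((hasDerivAt_id x).smul_const
        (EuclideanSpace.single 0 1 : EuclideanSpace ℝ (Fin 2))).add_const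
          (y • (EuclideanSpace.single 1 1 : EuclideanSpace ℝ (Fin 2)))
    exact (hudiff _).hasFDerivAt.comp_hasDerivAt x h1
  · intro x y
    have h1 : HasDerivAt (fun s => planeEquiv (x, s)) (EuclideanSpace.single 1 1) y := by
      simp only [planeEquiv_eq_add_smul]
      simpa using ((hasDerivAt_id y).smul_const
        (EuclideanSpace.single 1 1 : EuclideanSpace ℝ (Fin 2))).const_add
          (x • (EuclideanSpace.single 0 1 : EuclideanSpace ℝ (Fin 2)))
    exact (hudiff _).hasFDerivAt.comp_hasDerivAt y h1
  · intro p
    set a := fderiv ℝ u (planeEquiv p) (EuclideanSpace.single 0 1)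
    set b := fderiv ℝ u (planeEquiv p) (EuclideanSpace.single 1 1)
    rcases eq_or_ne (√(a ^ 2 + b ^ 2)) 0 with h0 | h0
    · rw [h0]; exact ENNReal.toReal_nonneg
    · have hr : 0 < √(a ^ 2 + b ^ 2) := lt_of_le_of_ne (sqrt_nonneg _) h0.symm
      have hr2 : √(a ^ 2 + b ^ 2) ^ 2 = a ^ 2 + b ^ 2 := sq_sqrt (by positivity)
      set r := √(a ^ 2 + b ^ 2)
      have he : ‖planeEquiv (a / r, b / r)‖ = 1 := by
        rw [EuclideanSpace.norm_eq, sqrt_eq_one]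
        simp only [planeEquiv_apply, Fin.sum_univ_two, norm_eq_abs, sq_abs]
        simp only [Matrix.cons_val_zero, Matrix.cons_val_one]
        field_simp
        exact hr2.symm
      have hle := fderiv_apply_le_toReal_lintegral_frontier hkc (fun z => (hk0 z).le) hkK hki hB0
        hlip hΩ hrect he (hudiff (planeEquiv p)).hasFDerivAt
      refine le_trans (le_of_eq ?_) hle
      rw [planeEquiv_eq_add_smul (a / r) (b / r), map_add, map_smul, map_smul, smul_eq_mul, smul_eq_mul]
      change r = a / r * a + b / r * b
      field_simp
      exact hr2

theorem hasFDerivAt_gaussian (a b : ℝ) (z : EuclideanSpace ℝ (Fin 2)) :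
    HasFDerivAt (fun z : EuclideanSpace ℝ (Fin 2) => a * exp (-b * ‖z‖ ^ 2))
      ((a * exp (-b * ‖z‖ ^ 2) * (-b) * 2) • innerSL ℝ z) z := by
  have h := (((hasStrictFDerivAt_norm_sq z).hasFDerivAt.const_mul (-b)).exp).const_mul a
  refine h.congr_fderiv ?_
  ext w
  simp
  ring

theorem norm_fderiv_gaussian_le {a b : ℝ} (ha : 0 < a) (hb : 0 < b)
    (z : EuclideanSpace ℝ (Fin 2)) :
    ‖(a * exp (-b * ‖z‖ ^ 2) * (-b) * 2) • innerSL ℝ z‖ ≤ 2 * a * b * (1 + 1 / b) := by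
  rw [norm_smul, innerSL_apply_norm, norm_eq_abs, abs_mul, abs_mul, abs_neg, abs_two,
    abs_of_pos hb, abs_of_pos (by positivity)]
  have h1 : ‖z‖ * exp (-b * ‖z‖ ^ 2) ≤ 1 + 1 / b := by
    rw [neg_mul, exp_neg, ← div_eq_mul_inv, div_le_iff₀ (exp_pos _)]
    have h2 : (1 + 1 / b) * (b * ‖z‖ ^ 2 + 1) ≤ (1 + 1 / b) * exp (b * ‖z‖ ^ 2) := by
      gcongr
      exact add_one_le_exp _
    refine le_trans ?_ h2
    have h3 : (1 + 1 / b) * (b * ‖z‖ ^ 2 + 1) = b * ‖z‖ ^ 2 + 1 + ‖z‖ ^ 2 + 1 / b := by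
      field_simp
      ring
    have : 0 < 1 / b := by positivity
    nlinarith [sq_nonneg (‖z‖ - 1), mul_nonneg hb.le (sq_nonneg ‖z‖)]
  calc a * exp (-b * ‖z‖ ^ 2) * b * 2 * ‖z‖ = 2 * a * b * (‖z‖ * exp (-b * ‖z‖ ^ 2)) := by ring
    _ ≤ _ := by gcongr

theorem exists_integrable_dominating_gaussian {a b : ℝ} (ha : 0 < a) (hb : 0 < b) (R : ℝ) :
    ∃ h : ℝ → ℝ, Integrable h ∧ ∀ z w : EuclideanSpace ℝ (Fin 2), ‖w‖ ≤ R →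
      a * exp (-b * ‖z - w‖ ^ 2) ≤ h (z 1) := by
  refine ⟨fun y => a * exp (b * R ^ 2) * exp (-(b / 2) * y ^ 2),
    (integrable_exp_neg_mul_sq (by positivity)).const_mul _, fun z w hw => ?_⟩
  change a * exp _ ≤ a * exp (b * R ^ 2) * exp (-(b / 2) * z 1 ^ 2)
  rw [mul_assoc, ← exp_add]
  gcongr
  have h1 : |(z - w) 1| ≤ ‖z - w‖ := PiLp.norm_apply_le (z - w) 1
  have h2 : |w 1| ≤ R := (PiLp.norm_apply_le w 1).trans hw
  have h3 : (z 1 - w 1) ^ 2 ≤ ‖z - w‖ ^ 2 := by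
    rw [← sq_abs]; gcongr; exact h1
  have h4 : w 1 ^ 2 ≤ R ^ 2 := by rw [← sq_abs]; gcongr
  have h5 : z 1 ^ 2 / 2 ≤ ‖z - w‖ ^ 2 + R ^ 2 := by nlinarith [sq_nonneg (z 1 - 2 * w 1)]
  nlinarith

/-- Isoperimetric inequality in the plane: for a bounded open set with
rectifiable (finite length) boundary, `4π · area ≤ perimeter²`, i.e. the
Polsby-Popper score lies in `[0,1]`. -/
theorem stmt_0 (Ω : Set (EuclideanSpace ℝ (Fin 2))) (hopen : IsOpen Ω)
    (hbdd : Bornology.IsBounded Ω)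
    (hrect : μH[1] (frontier Ω) < ⊤) :
    4 * π * (volume Ω).toReal ≤ ((μH[1] (frontier Ω)).toReal) ^ 2 := by
  rcases Ω.eq_empty_or_nonempty with rfl | hne
  · simp
  have hvol : volume Ω < ⊤ := hbdd.measure_lt_top
  have hfin : IsFiniteMeasure (volume.restrict Ω) := ⟨by simpa using hvol⟩
  set k : ℝ → EuclideanSpace ℝ (Fin 2) → ℝ := fun c z => c ^ 2 * exp (-(π * c ^ 2) * ‖z‖ ^ 2)
  set u : ℝ → EuclideanSpace ℝ (Fin 2) → ℝ := fun c z => ∫ w in Ω, k c (z - w)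
  have hkey : ∀ c, 0 < c → Continuous (u c) ∧ (∀ z, 0 ≤ u c z) ∧ (∀ z, u c z ≤ 1) ∧
      4 * π * ∫ z in Ω, u c z ^ 2 ≤ ((μH[1] (frontier Ω)).toReal) ^ 2 := fun c hc => by
    have ha : 0 < c ^ 2 := by positivity
    have hb : 0 < π * c ^ 2 := by positivity
    have hint : ∫ z, k c z = 1 := by
      simp only [k]
      rw [integral_const_mul, GaussianFourier.integral_rexp_neg_mul_sq_norm hb]
      simp only [finrank_euclideanSpace, Fintype.card_fin, Nat.cast_ofNat]
      rw [div_self (two_ne_zero' ℝ), rpow_one]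
      field_simp
    refine four_pi_mul_integral_sq_mollified_le (K := c ^ 2) (fun z => by positivity)
      (fun z => ?_) (Integrable.of_integral_ne_zero (by rw [hint]; exact one_ne_zero)) hint
      (hasFDerivAt_gaussian _ _) (by fun_prop) (norm_fderiv_gaussian_le ha hb)
      (exists_integrable_dominating_gaussian ha hb) hopen hne hbdd hrect
    refine mul_le_of_le_one_right ha.le (exp_le_one_iff.2 ?_)
    rw [neg_mul]
    exact neg_nonpos.2 (by positivity)
  have hptw : ∀ z ∈ Ω, Tendsto (fun c => u c z) atTop (𝓝 1) := fun z hz => by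
    have hφ : Tendsto (fun x : EuclideanSpace ℝ (Fin 2) =>
        ‖x‖ ^ Module.finrank ℝ (EuclideanSpace ℝ (Fin 2)) * exp (-π * ‖x‖ ^ 2))
        (Bornology.cobounded _) (𝓝 0) := by
      have h1 : Tendsto (fun s : ℝ => s * exp (-π * s)) atTop (𝓝 0) := by
        simpa using tendsto_rpow_mul_exp_neg_mul_atTop_nhds_zero 1 π pi_pos
      simpa [Function.comp_def] using h1.comp ((tendsto_pow_atTop two_ne_zero).comp
        (tendsto_norm_cobounded_atTop (E := EuclideanSpace ℝ (Fin 2))))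
    have h1 := tendsto_integral_comp_smul_smul_of_integrable'
      (μ := (volume : Measure (EuclideanSpace ℝ (Fin 2))))
      (φ := fun x => exp (-π * ‖x‖ ^ 2)) (fun x => (exp_pos _).le)
      (by rw [GaussianFourier.integral_rexp_neg_mul_sq_norm pi_pos]; simp [pi_ne_zero]) hφ
      (g := Ω.indicator fun _ => (1 : ℝ)) (x₀ := z)
      ((integrable_indicator_iff hopen.measurableSet).2 (integrable_const _))
      (continuousAt_const.congr (by
        filter_upwards [hopen.mem_nhds hz] with w hw using (indicator_of_mem hw _).symm))
    rw [indicator_of_mem hz] at h1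
    refine h1.congr fun c => ?_
    simp only [u, k]
    rw [← integral_indicator hopen.measurableSet]
    refine integral_congr_ae (Eventually.of_forall fun w => ?_)
    by_cases hw : w ∈ Ω
    · simp [hw, norm_smul, mul_pow, mul_assoc]
    · simp [hw]
  have hlim : Tendsto (fun c => ∫ z in Ω, u c z ^ 2) atTop (𝓝 (∫ _ in Ω, (1 : ℝ))) := by
    refine tendsto_integral_filter_of_dominated_convergence (fun _ => 1) ?_ ?_
      (integrable_const _) ?_
    · filter_upwards [eventually_gt_atTop 0] with c hc
      exact ((hkey c hc).1.pow 2).aestronglyMeasurable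
    · filter_upwards [eventually_gt_atTop 0] with c hc
      refine Eventually.of_forall fun z => ?_
      rw [norm_of_nonneg (sq_nonneg _)]
      exact pow_le_one₀ ((hkey c hc).2.1 z) ((hkey c hc).2.2.1 z)
    · refine (ae_restrict_iff' hopen.measurableSet).2 (Eventually.of_forall fun z hz => ?_)
      simpa using (hptw z hz).pow 2
  have hone : ∫ _ in Ω, (1 : ℝ) = (volume Ω).toReal := by simp [measureReal_def]
  rw [hone] at hlim
  refine le_of_tendsto (hlim.const_mul (4 * π)) ?_
  filter_upwards [eventually_gt_atTop 0] with c hc using (hkey c hc).2.2.2
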